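/- arXiv:2412.08001 — 13 statements merged into one kernel-verified Lean document; each statement's English description precedes it below -/
import Mathlib

section
/- Let (A, ≺, ≻, ·) be an extended tridendriform algebra of weight (λ,κ) over a field k. Then the bilinear operation x ⋆ y := x≺y + x≻y + λ(x·y) is associative, i.e. (x⋆y)⋆z = x⋆(y⋆z) for all x,y,z ∈ A. -/
/-- A binary operation `f : A → A → A` is `k`-bilinear. -/
def IsBilinear (k : Type*) [Field k] {A : Type*} [AddCommGroup A] [Module k A]
    (f : A → A → A) : Prop :=
  (∀ (a : k) (x y z : A), f (a • x + y) z = a • f x z + f y z) ∧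
  (∀ (a : k) (x y z : A), f x (a • y + z) = a • f x y + f x z)

/-- `(A, ≺, ≻, ·)` is an extended tridendriform algebra of weight `(lam, kap)`:
the three operations are bilinear and satisfy the seven relations, where
`x ⋆ y = x ≺ y + x ≻ y + lam • (x · y)`. -/
def IsExtTridend (k : Type*) [Field k] {A : Type*} [AddCommGroup A] [Module k A]
    (lam kap : k) (prec succ dot : A → A → A) : Prop :=
  IsBilinear k prec ∧ IsBilinear k succ ∧ IsBilinear k dot ∧
  (∀ x y z : A,
    prec (prec x y) z
      = prec x (prec y z + succ y z + lam • dot y z) + kap • dot x (dot y z)) ∧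
  (∀ x y z : A, prec (succ x y) z = succ x (prec y z)) ∧
  (∀ x y z : A,
    succ (prec x y + succ x y + lam • dot x y) z + kap • dot (dot x y) z
      = succ x (succ y z)) ∧
  (∀ x y z : A, dot (succ x y) z = succ x (dot y z)) ∧
  (∀ x y z : A, dot (prec x y) z = dot x (succ y z)) ∧
  (∀ x y z : A, prec (dot x y) z = dot x (prec y z)) ∧
  (∀ x y z : A, dot (dot x y) z = dot x (dot y z))

namespace IsBilinear

variable {k A : Type*} [Field k] [AddCommGroup A] [Module k A] {f : A → A → A}

theorem add_add_smul_left (hf : IsBilinear k f) (a : k) (x y w z : A) :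
    f (x + y + a • w) z = f x z + f y z + a • f w z := by
  have h := hf.1 1 x y z
  rw [one_smul, one_smul] at h
  rw [add_comm (x + y), hf.1, h, add_comm]

theorem add_add_smul_right (hf : IsBilinear k f) (a : k) (x y z w : A) :
    f x (y + z + a • w) = f x y + f x z + a • f x w := by
  have h := hf.2 1 x y z
  rw [one_smul, one_smul] at h
  rw [add_comm (y + z), hf.2, h, add_comm]

end IsBilinear

/-- In an extended tridendriform algebra of weight `(lam, kap)`, the operation
`x ⋆ y := x ≺ y + x ≻ y + lam • (x · y)` is associative. -/
theorem extTridend_star_assoc {k A : Type*} [Field k] [AddCommGroup A] [Module k A]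
    (lam kap : k) (prec succ dot : A → A → A)
    (h : IsExtTridend k lam kap prec succ dot)
    (star : A → A → A)
    (hstar : ∀ x y, star x y = prec x y + succ x y + lam • dot x y) :
    ∀ x y z : A, star (star x y) z = star x (star y z) := by
  obtain ⟨hp, hs, hd, h₁, h₂, h₃, h₄, h₅, h₆, h₇⟩ := h
  intro x y z
  have hsucc := eq_sub_of_add_eq (h₃ x y z)
  simp only [hstar]
  rw [hsucc, hp.add_add_smul_left, hd.add_add_smul_left, hs.add_add_smul_right,
    hd.add_add_smul_right, h₁, h₂, h₄, h₅, h₆, h₇]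
  module
end

section
/- Let (R, P) be an extended Rota-Baxter algebra of weight (λ,κ) over a field k. Define x ≺ y := xP(y), x ≻ y := P(x)y, and x · y := xy. Then (R, ≺, ≻, ·) is an extended tridendriform algebra of weight (λ,κ). -/
/-- An extended Rota-Baxter algebra `(R, P)` of weight `(lam, kap)` induces an
extended tridendriform algebra of weight `(lam, kap)` via
`x ≺ y := x * P y`, `x ≻ y := P x * y`, `x · y := x * y`. -/
theorem extRotaBaxter_toExtTridend {k R : Type*} [Field k] [NonUnitalRing R]
    [Module k R] [SMulCommClass k R R] [IsScalarTower k R R]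
    (lam kap : k) (P : R →ₗ[k] R)
    (hP : ∀ x y : R,
      P x * P y = P (x * P y) + P (P x * y) + lam • P (x * y) + kap • (x * y)) :
    IsExtTridend k lam kap (fun x y => x * P y) (fun x y => P x * y)
      (fun x y => x * y) := by
  refine ⟨⟨?_, ?_⟩, ⟨?_, ?_⟩, ⟨?_, ?_⟩, ?_, ?_, ?_, ?_, ?_, ?_, ?_⟩
  case refine_7 =>
    intro x y z
    simp only [mul_assoc, hP, map_add, map_smul, mul_add, mul_smul_comm]
  case refine_9 =>
    intro x y z
    simp only [← mul_assoc, hP, map_add, map_smul, add_mul, smul_mul_assoc]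
  all_goals
    intros
    simp only [mul_assoc, map_add, map_smul, add_mul, mul_add, smul_mul_assoc, mul_smul_comm]
end

section
/- Let (R, P) be a modified Rota-Baxter algebra of weight κ over a field k, i.e. P(x)P(y) = P(xP(y)) + P(P(x)y) + κxy for all x,y ∈ R. Define x ≺ y := xP(y), x ≻ y := P(x)y, and x · y := xy. Then (R, ≺, ≻, ·) is a modified tridendriform algebra of weight κ, i.e. an extended tridendriform algebra of weight (0,κ). -/
/-- A modified Rota-Baxter algebra `(R, P)` of weight `kap` induces a modified
tridendriform algebra of weight `kap`, i.e. an extended tridendriform algebra of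
weight `(0, kap)`, via `x ≺ y := x * P y`, `x ≻ y := P x * y`, `x · y := x * y`. -/
theorem modifiedRotaBaxter_toModifiedTridend {k R : Type*} [Field k] [NonUnitalRing R]
    [Module k R] [SMulCommClass k R R] [IsScalarTower k R R]
    (kap : k) (P : R →ₗ[k] R)
    (hP : ∀ x y : R, P x * P y = P (x * P y) + P (P x * y) + kap • (x * y)) :
    IsExtTridend k 0 kap (fun x y => x * P y) (fun x y => P x * y)
      (fun x y => x * y) := by
  refine ⟨⟨?_, ?_⟩, ⟨?_, ?_⟩, ⟨?_, ?_⟩, fun x y z => ?_, ?_, fun x y z => ?_, ?_, ?_, ?_, ?_⟩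
  case refine_7 =>
    simp only [zero_smul, add_zero, map_add]
    rw [mul_assoc, hP, mul_add, mul_smul_comm]
  case refine_9 =>
    simp only [zero_smul, add_zero, map_add]
    rw [← mul_assoc, hP, add_mul _ (kap • _), smul_mul_assoc]
  all_goals
    intros
    simp only [map_add, map_smul, add_mul, mul_add, smul_mul_assoc, mul_smul_comm, mul_assoc]
end

section
/- Let (R, P) be a Rota-Baxter algebra of weight 0 over a field k, i.e. P(x)P(y) = P(xP(y)) + P(P(x)y) for all x,y ∈ R. Define x ≺ y := xP(y), x ≻ y := P(x)y, and x · y := xy. Then (R, ≺, ≻, ·) is a tridendriform algebra of weight 0, i.e. an extended tridendriform algebra of weight (0,0). -/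
/-- A Rota-Baxter algebra `(R, P)` of weight `0` induces a tridendriform algebra
of weight `0`, i.e. an extended tridendriform algebra of weight `(0, 0)`, via
`x ≺ y := x * P y`, `x ≻ y := P x * y`, `x · y := x * y`. -/
theorem rotaBaxterWeightZero_toTridendWeightZero {k R : Type*} [Field k] [NonUnitalRing R]
    [Module k R] [SMulCommClass k R R] [IsScalarTower k R R]
    (P : R →ₗ[k] R)
    (hP : ∀ x y : R, P x * P y = P (x * P y) + P (P x * y)) :
    IsExtTridend k 0 0 (fun x y => x * P y) (fun x y => P x * y)
      (fun x y => x * y) := by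
  refine ⟨⟨?_, ?_⟩, ⟨?_, ?_⟩, ⟨?_, ?_⟩, ?_, ?_, ?_, ?_, ?_, ?_, ?_⟩ <;> intros <;>
    simp only [map_add, map_smul, add_mul, mul_add, smul_mul_assoc, mul_smul_comm, zero_smul,
      add_zero, mul_assoc]
  · rw [hP, mul_add]
  · rw [← mul_assoc (P _), hP, add_mul]
end

section
/- Let (R, P) be an extended Rota-Baxter algebra of weight (λ,κ) over a field k. Define x ≺ y := xP(y) + λxy and x ≻ y := P(x)y. Then (R, ≺, ≻) is an extended dendriform algebra. -/
/-- `(A, ≺, ≻)` is an extended dendriform algebra: the two operations are bilinear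
and satisfy the two relations, where `x ⋆ y = x ≺ y + x ≻ y`. -/
def IsExtDend (k : Type*) [Field k] {A : Type*} [AddCommGroup A] [Module k A]
    (prec succ : A → A → A) : Prop :=
  IsBilinear k prec ∧ IsBilinear k succ ∧
  (∀ x y z : A,
    prec (prec x y) z + succ (prec x y + succ x y) z
      = prec x (prec y z + succ y z) + succ x (succ y z)) ∧
  (∀ x y z : A, prec (succ x y) z = succ x (prec y z))

/-- An extended Rota-Baxter algebra `(R, P)` of weight `(lam, kap)` induces an
extended dendriform algebra via `x ≺ y := x * P y + lam • (x * y)` and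
`x ≻ y := P x * y`. -/
theorem extRotaBaxter_toExtDend {k R : Type*} [Field k] [NonUnitalRing R]
    [Module k R] [SMulCommClass k R R] [IsScalarTower k R R]
    (lam kap : k) (P : R →ₗ[k] R)
    (hP : ∀ x y : R,
      P x * P y = P (x * P y) + P (P x * y) + lam • P (x * y) + kap • (x * y)) :
    IsExtDend k (fun x y => x * P y + lam • (x * y)) (fun x y => P x * y) := by
  have hP_star (x y : R) :
      P (x * P y + lam • (x * y) + P x * y) = P x * P y - kap • (x * y) := by
    rw [hP x y]
    simp only [map_add, map_smul]
    abel
  refine ⟨⟨fun a x y z => ?_, fun a x y z => ?_⟩, ⟨fun a x y z => ?_, fun a x y z => ?_⟩,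
    fun x y z => ?_, fun x y z => ?_⟩
  · simp only [add_mul, smul_mul_assoc, smul_add, smul_comm lam a]
    abel
  · simp only [map_add, map_smul, mul_add, mul_smul_comm, smul_add, smul_comm lam a]
    abel
  · simp only [map_add, map_smul, add_mul, smul_mul_assoc]
  · simp only [mul_add, mul_smul_comm]
  · simp only [hP_star]
    simp only [add_mul, mul_add, sub_mul, mul_sub, smul_mul_assoc, mul_smul_comm, smul_add,
      mul_assoc]
    abel
  · simp only [mul_add, mul_smul_comm, mul_assoc]
end

section
/- Let (R, P) be a modified Rota-Baxter algebra of weight κ over a field k, i.e. P(x)P(y) = P(xP(y)) + P(P(x)y) + κxy for all x,y ∈ R. Define x ≺ y := xP(y) and x ≻ y := P(x)y. Then (R, ≺, ≻) is an extended dendriform algebra. -/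
/-- A modified Rota-Baxter algebra `(R, P)` of weight `kap` induces an extended
dendriform algebra via `x ≺ y := x * P y` and `x ≻ y := P x * y`. -/
theorem modifiedRotaBaxter_toExtDend {k R : Type*} [Field k] [NonUnitalRing R]
    [Module k R] [SMulCommClass k R R] [IsScalarTower k R R]
    (kap : k) (P : R →ₗ[k] R)
    (hP : ∀ x y : R, P x * P y = P (x * P y) + P (P x * y) + kap • (x * y)) :
    IsExtDend k (fun x y => x * P y) (fun x y => P x * y) := by
  have h : ∀ x y : R, P (x * P y + P x * y) = P x * P y - kap • (x * y) := fun x y => by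
    rw [hP, map_add, add_sub_cancel_right]
  refine ⟨⟨fun a x y z => ?_, fun a x y z => ?_⟩, ⟨fun a x y z => ?_, fun a x y z => ?_⟩,
    fun x y z => ?_, fun x y z => mul_assoc _ _ _⟩
  · simp only [add_mul, smul_mul_assoc]
  · simp only [map_add, map_smul, mul_add, mul_smul_comm]
  · simp only [map_add, map_smul, add_mul, smul_mul_assoc]
  · simp only [mul_add, mul_smul_comm]
  · simp only [h, sub_mul, mul_sub, smul_mul_assoc, mul_smul_comm, mul_assoc]
    abel
end

section
/- Let (A, ≺, ≻, ·) be an extended tridendriform algebra of weight (λ,κ) over a field k. Define [x,y] := x·y − y·x and x ∘ y := x≻y − y≺x. Then (A, [,], ∘) is an extended post-Lie algebra of weight (λ,κ). -/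
/-- `(A, br, circ)` is an extended post-Lie algebra of weight `(lam, kap)`:
`br` is a Lie bracket (bilinear, alternating, Jacobi) and the bilinear
operation `circ` satisfies the two compatibility conditions. -/
def IsExtPostLie (k : Type*) [Field k] {A : Type*} [AddCommGroup A] [Module k A]
    (lam kap : k) (br circ : A → A → A) : Prop :=
  IsBilinear k br ∧ IsBilinear k circ ∧
  (∀ x : A, br x x = 0) ∧
  (∀ x y z : A, br (br x y) z + br (br y z) x + br (br z x) y = 0) ∧
  (∀ x y z : A,
    circ (circ x y) z - circ (circ y x) z + lam • circ (br x y) z + kap • br (br x y) z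
      = circ x (circ y z) - circ y (circ x z)) ∧
  (∀ x y z : A, circ x (br y z) = br (circ x y) z + br y (circ x z))

namespace IsBilinear

variable {k A : Type*} [Field k] [AddCommGroup A] [Module k A] {f g : A → A → A}

theorem add_left (hf : IsBilinear k f) (x y z : A) : f (x + y) z = f x z + f y z := by
  simpa using hf.1 1 x y z

theorem add_right (hf : IsBilinear k f) (x y z : A) : f x (y + z) = f x y + f x z := by
  simpa using hf.2 1 x y z

theorem sub_left (hf : IsBilinear k f) (x y z : A) : f (x - y) z = f x z - f y z := by
  rw [eq_sub_iff_add_eq, ← hf.add_left, sub_add_cancel]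

theorem sub_right (hf : IsBilinear k f) (x y z : A) : f x (y - z) = f x y - f x z := by
  rw [eq_sub_iff_add_eq, ← hf.add_right, sub_add_cancel]

theorem zero_left (hf : IsBilinear k f) (y : A) : f 0 y = 0 := by
  simpa using hf.sub_left 0 0 y

theorem zero_right (hf : IsBilinear k f) (x : A) : f x 0 = 0 := by
  simpa using hf.sub_right x 0 0

theorem smul_left (hf : IsBilinear k f) (a : k) (x y : A) : f (a • x) y = a • f x y := by
  simpa [hf.zero_left] using hf.1 a x 0 y

theorem smul_right (hf : IsBilinear k f) (a : k) (x y : A) : f x (a • y) = a • f x y := by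
  simpa [hf.zero_right] using hf.2 a x y 0

theorem sub_flip (hf : IsBilinear k f) (hg : IsBilinear k g) :
    IsBilinear k (fun x y => f x y - g y x) := by
  refine ⟨fun a x y z => ?_, fun a x y z => ?_⟩
  · simp only [hf.1, hg.2]
    module
  · simp only [hf.2, hg.1]
    module

end IsBilinear

/-- An extended tridendriform algebra of weight `(lam, kap)` induces an extended
post-Lie algebra of weight `(lam, kap)` via `[x, y] := x · y - y · x` and
`x ∘ y := x ≻ y - y ≺ x`. -/
theorem extTridend_toExtPostLie {k A : Type*} [Field k] [AddCommGroup A] [Module k A]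
    (lam kap : k) (prec succ dot : A → A → A)
    (h : IsExtTridend k lam kap prec succ dot) :
    IsExtPostLie k lam kap (fun x y => dot x y - dot y x)
      (fun x y => succ x y - prec y x) := by
  obtain ⟨hp, hs, hd, h1, h2, h3, h4, h5, h6, h7⟩ := h
  refine ⟨hd.sub_flip hd, hs.sub_flip hp, fun x => sub_self _, fun x y z => ?_,
    fun x y z => ?_, fun x y z => ?_⟩
  · simp only [hd.sub_left, hd.sub_right, h7]
    abel
  · simp only [hp.add_right, hp.smul_right] at h1
    simp only [hs.add_left, hs.smul_left] at h3
    simp only [hd.sub_left, hd.sub_right, hp.sub_left, hp.sub_right, hs.sub_left, hs.sub_right,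
      h2, ← h3, h1, h7]
    module
  · simp only [hd.sub_left, hd.sub_right, hp.sub_left, hs.sub_right, h4, h5, h6]
    abel
end

section
/- Let (A, ≺, ≻, ·) be a modified tridendriform algebra of weight κ over a field k, i.e. an extended tridendriform algebra of weight (0,κ). Define [x,y] := x·y − y·x and x ∘ y := x≻y − y≺x. Then (A, [,], ∘) is a modified post-Lie algebra of weight κ, i.e. an extended post-Lie algebra of weight (0,κ). -/
section

variable {k A : Type*} [Field k] [AddCommGroup A] [Module k A] {f g : A → A → A}

theorem IsBilinear.add_left_s9 (hf : IsBilinear k f) (x y z : A) :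
    f (x + y) z = f x z + f y z := by
  simpa using hf.1 1 x y z

theorem IsBilinear.add_right_s9 (hf : IsBilinear k f) (x y z : A) :
    f x (y + z) = f x y + f x z := by
  simpa using hf.2 1 x y z

theorem IsBilinear.sub_left_s9 (hf : IsBilinear k f) (x y z : A) :
    f (x - y) z = f x z - f y z := by
  rw [eq_sub_iff_add_eq, ← hf.add_left_s9, sub_add_cancel]

theorem IsBilinear.sub_right_s9 (hf : IsBilinear k f) (x y z : A) :
    f x (y - z) = f x y - f x z := by
  rw [eq_sub_iff_add_eq, ← hf.add_right_s9, sub_add_cancel]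

theorem IsBilinear.swap (hf : IsBilinear k f) : IsBilinear k (fun x y => f y x) :=
  ⟨fun a x y z => hf.2 a z x y, fun a x y z => hf.1 a y z x⟩

theorem IsBilinear.sub (hf : IsBilinear k f) (hg : IsBilinear k g) :
    IsBilinear k (fun x y => f x y - g x y) :=
  ⟨fun a x y z => by simp only [hf.1, hg.1]; module,
    fun a x y z => by simp only [hf.2, hg.2]; module⟩

end

/-- A modified tridendriform algebra of weight `kap` (an extended tridendriform
algebra of weight `(0, kap)`) induces a modified post-Lie algebra of weight `kap`
(an extended post-Lie algebra of weight `(0, kap)`) via `[x, y] := x · y - y · x`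
and `x ∘ y := x ≻ y - y ≺ x`. -/
theorem modifiedTridend_toModifiedPostLie {k A : Type*} [Field k] [AddCommGroup A]
    [Module k A] (kap : k) (prec succ dot : A → A → A)
    (h : IsExtTridend k 0 kap prec succ dot) :
    IsExtPostLie k 0 kap (fun x y => dot x y - dot y x)
      (fun x y => succ x y - prec y x) := by
  obtain ⟨hp, hs, hd, h1, h2, h3, h4, h5, h6, h7⟩ := h
  simp only [zero_smul, add_zero, hp.add_right_s9, hs.add_left_s9] at h1 h3
  refine ⟨hd.sub hd.swap, hs.sub hp.swap, fun x => sub_self _, fun x y z => ?_,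
    fun x y z => ?_, fun x y z => ?_⟩
  · simp only [hd.sub_left_s9, hd.sub_right_s9, h7]
    abel
  · simp only [hp.sub_left_s9, hp.sub_right_s9, hs.sub_left_s9, hs.sub_right_s9, hd.sub_left_s9, hd.sub_right_s9,
      zero_smul, add_zero, h2, h1 z x y, h1 z y x, ← h3 x y z, ← h3 y x z]
    module
  · simp only [hp.sub_left_s9, hs.sub_right_s9, hd.sub_left_s9, hd.sub_right_s9, h4, h5, h6]
    abel
end

section
/- Let (g, [,], P) be an extended Rota-Baxter Lie algebra of weight (λ,κ) over a field k. Define x ∘ y := [P(x), y]. Then (g, [,], ∘) is an extended post-Lie algebra of weight (λ,κ). -/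
/-- An extended Rota-Baxter Lie algebra `(g, [,], P)` of weight `(lam, kap)`
induces an extended post-Lie algebra of weight `(lam, kap)` via
`x ∘ y := [P x, y]`. -/
theorem extRotaBaxterLie_toExtPostLie {k g : Type*} [Field k] [LieRing g]
    [LieAlgebra k g] (lam kap : k) (P : g →ₗ[k] g)
    (hP : ∀ x y : g,
      ⁅P x, P y⁆ = P (⁅P x, y⁆ + ⁅x, P y⁆ + lam • ⁅x, y⁆) + kap • ⁅x, y⁆) :
    IsExtPostLie k lam kap (fun x y => ⁅x, y⁆) (fun x y => ⁅P x, y⁆) := by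
  refine ⟨⟨fun a x y z => ?_, fun a x y z => ?_⟩, ⟨fun a x y z => ?_, fun a x y z => ?_⟩,
    fun x => lie_self x, fun x y z => ?_, fun x y z => ?_, fun x y z => leibniz_lie _ _ _⟩
  · simp
  · simp
  · simp
  · simp
  · have h := lie_jacobi x y z
    rw [← lie_skew x ⁅y, z⁆, ← lie_skew y ⁅z, x⁆, ← lie_skew z ⁅x, y⁆] at h
    rw [← neg_eq_zero, ← h]
    abel
  · have hxy : ⁅P x, P y⁆
        = P ⁅P x, y⁆ - P ⁅P y, x⁆ + lam • P ⁅x, y⁆ + kap • ⁅x, y⁆ := by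
      rw [hP, ← lie_skew x (P y)]
      simp only [map_add, map_neg, map_smul, sub_eq_add_neg]
    simp only [← lie_lie, hxy, add_lie, sub_lie, smul_lie]
end

section
/- Let (g, [,], P) be a modified Rota-Baxter Lie algebra of weight κ over a field k, i.e. [P(x),P(y)] = P([P(x),y] + [x,P(y)]) + κ[x,y] for all x,y ∈ g. Define x ∘ y := [P(x), y]. Then (g, [,], ∘) is a modified post-Lie algebra of weight κ, i.e. an extended post-Lie algebra of weight (0,κ). -/
/-- A modified Rota-Baxter Lie algebra `(g, [,], P)` of weight `kap` induces a
modified post-Lie algebra of weight `kap` (an extended post-Lie algebra of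
weight `(0, kap)`) via `x ∘ y := [P x, y]`. -/
theorem modifiedRotaBaxterLie_toModifiedPostLie {k g : Type*} [Field k] [LieRing g]
    [LieAlgebra k g] (kap : k) (P : g →ₗ[k] g)
    (hP : ∀ x y : g, ⁅P x, P y⁆ = P (⁅P x, y⁆ + ⁅x, P y⁆) + kap • ⁅x, y⁆) :
    IsExtPostLie k 0 kap (fun x y => ⁅x, y⁆) (fun x y => ⁅P x, y⁆) := by
  refine ⟨⟨?_, ?_⟩, ⟨?_, ?_⟩, fun x => lie_self x, ?_, ?_, fun x y z => leibniz_lie (P x) y z⟩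
  · intro a x y z
    simp only [add_lie, smul_lie]
  · intro a x y z
    simp only [lie_add, lie_smul]
  · intro a x y z
    simp only [map_add, map_smul, add_lie, smul_lie]
  · intro a x y z
    simp only [lie_add, lie_smul]
  · intro x y z
    have h := lie_jacobi x y z
    rw [← lie_skew x, ← lie_skew y ⁅z, x⁆, ← lie_skew z ⁅x, y⁆] at h
    rw [← neg_eq_zero, ← h]
    abel
  · intro x y z
    have hyx : P ⁅P y, x⁆ = -P ⁅x, P y⁆ := by rw [← lie_skew, map_neg]
    dsimp only
    rw [← lie_lie, hP, hyx, map_add, neg_lie, add_lie, add_lie, smul_lie, zero_smul]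
    abel
end

section
/- Let (g, [,], P) be a Rota-Baxter Lie algebra of weight λ over a field k, i.e. [P(x),P(y)] = P([P(x),y] + [x,P(y)] + λ[x,y]) for all x,y ∈ g. Define x ∘ y := [P(x), y]. Then (g, [,], ∘) is a post-Lie algebra of weight λ, i.e. an extended post-Lie algebra of weight (λ,0). -/
/-- A Rota-Baxter Lie algebra `(g, [,], P)` of weight `lam` induces a post-Lie
algebra of weight `lam` (an extended post-Lie algebra of weight `(lam, 0)`) via
`x ∘ y := [P x, y]`. -/
theorem rotaBaxterLie_toPostLie {k g : Type*} [Field k] [LieRing g]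
    [LieAlgebra k g] (lam : k) (P : g →ₗ[k] g)
    (hP : ∀ x y : g, ⁅P x, P y⁆ = P (⁅P x, y⁆ + ⁅x, P y⁆ + lam • ⁅x, y⁆)) :
    IsExtPostLie k lam 0 (fun x y => ⁅x, y⁆) (fun x y => ⁅P x, y⁆) := by
  refine ⟨⟨by simp, by simp⟩, ⟨by simp, by simp⟩, lie_self, ?_, ?_,
    fun x y z => leibniz_lie (P x) y z⟩
  · intro x y z
    change ⁅⁅x, y⁆, z⁆ + ⁅⁅y, z⁆, x⁆ + ⁅⁅z, x⁆, y⁆ = 0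
    rw [← lie_skew ⁅x, y⁆ z, ← lie_skew ⁅y, z⁆ x, ← lie_skew ⁅z, x⁆ y,
      ← neg_add, ← neg_add, neg_eq_zero]
    exact lie_jacobi z x y
  · intro x y z
    have hxy : P ⁅P x, y⁆ - P ⁅P y, x⁆ + lam • P ⁅x, y⁆ = ⁅P x, P y⁆ := by
      rw [hP, ← lie_skew x (P y)]
      simp only [map_add, map_neg, map_smul]
      abel
    simp only [zero_smul, add_zero]
    rw [← smul_lie, ← sub_lie, ← add_lie, hxy, lie_lie]
end

section
/- Let (A, ⊲, ⊳, ∘) be an extended pre-Lie algebra over a field k. Define [x,y] := x∘y − y∘x. Then [,] is a Lie bracket on A, i.e. it is bilinear, skew-symmetric, and satisfies the Jacobi identity [[x,y],z] + [[y,z],x] + [[z,x],y] = 0 for all x,y,z ∈ A. -/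
/-- `(A, tl, tr, circ)` is an extended pre-Lie algebra: the three operations are
bilinear and satisfy the two relations, where `x ∗ y := tl x y + tr x y`
(`tl` is `⊲` and `tr` is `⊳`). -/
def IsExtPreLie (k : Type*) [Field k] {A : Type*} [AddCommGroup A] [Module k A]
    (tl tr circ : A → A → A) : Prop :=
  IsBilinear k tl ∧ IsBilinear k tr ∧ IsBilinear k circ ∧
  (∀ x y z : A,
    tl (tl x y) z - tl x (tl y z + tr y z) + tr (tl x y + tr x y) z - tr x (tr y z)
      = tl (tl y x) z - tl y (tl x z + tr x z) + tr (tl y x + tr y x) z - tr y (tr x z)) ∧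
  (∀ x y z : A,
    circ (circ x y) z - circ x (circ y z) + tl (tl x y) z - tl x (tl y z + tr y z)
        + tr z (tr y x) - tr (tl z y + tr z y) x
      = circ (circ y x) z - circ y (circ x z) + tl (tl y x) z - tl y (tl x z + tr x z)
        + tr z (tr x y) - tr (tl z x + tr z x) y)

/-- In an extended pre-Lie algebra, the operation `[x, y] := x ∘ y - y ∘ x` is a
Lie bracket: bilinear, skew-symmetric and satisfying the Jacobi identity. -/
theorem extPreLie_commutator_isLieBracket {k A : Type*} [Field k] [AddCommGroup A]
    [Module k A] (tl tr circ : A → A → A) (h : IsExtPreLie k tl tr circ)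
    (br : A → A → A) (hbr : ∀ x y, br x y = circ x y - circ y x) :
    IsBilinear k br ∧
    (∀ x y : A, br x y = - br y x) ∧
    (∀ x y z : A, br (br x y) z + br (br y z) x + br (br z x) y = 0) := by
  obtain ⟨-, -, ⟨hl, hr⟩, h₁, h₂⟩ := h
  have sub_left : ∀ x y z, circ (x - y) z = circ x z - circ y z := fun x y z => by
    have e := hl (-1) y x z
    rw [neg_one_smul, neg_one_smul, neg_add_eq_sub, neg_add_eq_sub] at e
    exact e
  have sub_right : ∀ x y z, circ x (y - z) = circ x y - circ x z := fun x y z => by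
    have e := hr (-1) x z y
    rw [neg_one_smul, neg_one_smul, neg_add_eq_sub, neg_add_eq_sub] at e
    exact e
  refine ⟨⟨fun a x y z => ?_, fun a x y z => ?_⟩, fun x y => ?_, fun x y z => ?_⟩
  · simp only [hbr, hl, hr]
    module
  · simp only [hbr, hl, hr]
    module
  · simp only [hbr, neg_sub]
  -- The alternating sum of the second relation minus that of the first.
  · simp only [hbr, sub_left, sub_right]
    linear_combination (norm := abel) h₂ x y z + h₂ y z x + h₂ z x y
      - h₁ x y z - h₁ y z x - h₁ z x y
end

section
/- Let sl(2,ℂ) be the special linear Lie algebra of traceless 2×2 complex matrices, with Cartan–Weyl basis e = [[0,1],[0,0]], f = [[0,0],[1,0]], h = [[1,0],[0,-1]]. Let P: sl(2,ℂ) → sl(2,ℂ) be the ℂ-linear map determined by P(e) = −2e + h, P(f) = f + (3/4)h, P(h) = −(3/2)e − 2f − (1/2)h. Then P is an extended Rota-Baxter operator of weight (1,1) on sl(2,ℂ), i.e. [P(x),P(y)] = P([P(x),y] + [x,P(y)] + [x,y]) + [x,y] for all x,y ∈ sl(2,ℂ). -/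
open LieAlgebra.SpecialLinear

/-- The elementary matrix `e` of the Cartan-Weyl basis of `sl(2, ℂ)`. -/
noncomputable def sle : sl (Fin 2) ℂ :=
  ⟨!![0, 1; 0, 0], show _ ∈ LinearMap.ker (Matrix.traceLinearMap (Fin 2) ℂ ℂ) by simp [LinearMap.mem_ker, Matrix.trace_fin_two]⟩

/-- The elementary matrix `f` of the Cartan-Weyl basis of `sl(2, ℂ)`. -/
noncomputable def slf : sl (Fin 2) ℂ :=
  ⟨!![0, 0; 1, 0], show _ ∈ LinearMap.ker (Matrix.traceLinearMap (Fin 2) ℂ ℂ) by simp [LinearMap.mem_ker, Matrix.trace_fin_two]⟩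

/-- The diagonal matrix `h` of the Cartan-Weyl basis of `sl(2, ℂ)`. -/
noncomputable def slh : sl (Fin 2) ℂ :=
  ⟨!![1, 0; 0, -1], show _ ∈ LinearMap.ker (Matrix.traceLinearMap (Fin 2) ℂ ℂ) by simp [LinearMap.mem_ker, Matrix.trace_fin_two]⟩

theorem lie_sle_slf : ⁅sle, slf⁆ = slh := by
  ext i j
  fin_cases i <;> fin_cases j <;>
    simp [sle, slf, slh, LieSubalgebra.coe_bracket, Ring.lie_def]

theorem lie_slh_sle : ⁅slh, sle⁆ = (2 : ℂ) • sle := by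
  ext i j
  fin_cases i <;> fin_cases j <;>
    norm_num [sle, slh, LieSubalgebra.coe_bracket, Ring.lie_def]

theorem lie_slh_slf : ⁅slh, slf⁆ = (-2 : ℂ) • slf := by
  ext i j
  fin_cases i <;> fin_cases j <;>
    norm_num [slf, slh, LieSubalgebra.coe_bracket, Ring.lie_def]

theorem exists_eq_smul_sle_add_smul_slf_add_smul_slh (x : sl (Fin 2) ℂ) :
    ∃ a b c : ℂ, x = a • sle + b • slf + c • slh := by
  refine ⟨x.1 0 1, x.1 1 0, x.1 0 0, ?_⟩
  have htr : x.1 0 0 + x.1 1 1 = 0 := by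
    rw [← Matrix.trace_fin_two]
    exact x.2
  ext i j
  fin_cases i <;> fin_cases j <;> simp [sle, slf, slh]
  linear_combination htr

/-- The `ℂ`-linear map on `sl(2, ℂ)` determined by `P e = -2e + h`,
`P f = f + (3/4)h`, `P h = -(3/2)e - 2f - (1/2)h` is an extended Rota-Baxter
operator of weight `(1, 1)`. -/
theorem slTwo_extRotaBaxter_weight_one_one
    (P : sl (Fin 2) ℂ →ₗ[ℂ] sl (Fin 2) ℂ)
    (hPe : P sle = (-2 : ℂ) • sle + slh)
    (hPf : P slf = slf + (3 / 4 : ℂ) • slh)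
    (hPh : P slh = (-(3 / 2) : ℂ) • sle + (-2 : ℂ) • slf + (-(1 / 2) : ℂ) • slh) :
    ∀ x y : sl (Fin 2) ℂ,
      ⁅P x, P y⁆ = P (⁅P x, y⁆ + ⁅x, P y⁆ + ⁅x, y⁆) + ⁅x, y⁆ := by
  have hfe : ⁅slf, sle⁆ = -slh := by rw [← lie_skew, lie_sle_slf]
  have heh : ⁅sle, slh⁆ = (-2 : ℂ) • sle := by rw [← lie_skew, lie_slh_sle, neg_smul]
  have hfh : ⁅slf, slh⁆ = (2 : ℂ) • slf := by rw [← lie_skew, lie_slh_slf, neg_smul, neg_neg]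
  intro x y
  obtain ⟨a, b, c, rfl⟩ := exists_eq_smul_sle_add_smul_slf_add_smul_slh x
  obtain ⟨a', b', c', rfl⟩ := exists_eq_smul_sle_add_smul_slf_add_smul_slh y
  simp only [map_add, map_smul, map_neg, hPe, hPf, hPh, lie_add, add_lie, lie_smul, smul_lie,
    lie_self, lie_sle_slf, lie_slh_sle, lie_slh_slf, hfe, heh, hfh, smul_zero, smul_neg, map_zero]
  module
end
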